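/- Let f, g be proper convex lower semicontinuous functions on a real Hilbert space H with zer(∂f+∂g) nonempty, and let (y^k), (x^k), (w^k) be generated by the inertial Douglas–Rachford iteration (2.5) with parameters satisfying 0 ≤ α_k ≤ α < 1, 0 < λ̲ ≤ λ_k ≤ λ̄ < 2 and Σ_k α_k‖w^k − w^{k−1}‖² < +∞. Then there exists x̄ ∈ H such that prox_{γg}(x̄) ∈ zer(∂f+∂g), the sequence (w^k) converges weakly to x̄, and ‖y^k − x^k‖ → 0 as k → +∞. -/

import Mathlib

open Filter Topology Pointwise
open scoped RealInnerProductSpace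

noncomputable section

/-- `f` is proper, convex and lower semicontinuous (extended-real-valued). -/
def ProperConvexLSC {H : Type*} [NormedAddCommGroup H] [InnerProductSpace ℝ H]
    (f : H → EReal) : Prop :=
  (∀ x, f x ≠ ⊥) ∧ (∃ x, f x ≠ ⊤) ∧
    (∀ x y : H, ∀ a b : ℝ, 0 ≤ a → 0 ≤ b → a + b = 1 →
      f (a • x + b • y) ≤ (a : EReal) * f x + (b : EReal) * f y) ∧
    LowerSemicontinuous f

/-- The convex subdifferential `∂f(x)`. -/
def subdiff {H : Type*} [NormedAddCommGroup H] [InnerProductSpace ℝ H]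
    (f : H → EReal) (x : H) : Set H :=
  {w | ∀ z, f x + ((⟪w, z - x⟫ : ℝ) : EReal) ≤ f z}

/-- Weak convergence of a sequence in a Hilbert space. -/
def WeakTendsto {H : Type*} [NormedAddCommGroup H] [InnerProductSpace ℝ H]
    (x : ℕ → H) (l : H) : Prop :=
  ∀ z : H, Tendsto (fun k => ⟪x k, z⟫) atTop (𝓝 (⟪l, z⟫))

/-- `p` is the proximal point of parameter `γ` of `f` at `c`, i.e. the
minimizer of `z ↦ γ f(z) + (1/2)‖z - c‖²`. -/
def IsProx {H : Type*} [NormedAddCommGroup H] [InnerProductSpace ℝ H]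
    (γ : ℝ) (f : H → EReal) (c p : H) : Prop :=
  ∀ z, (γ : EReal) * f p + ((1 / 2 * ‖p - c‖ ^ 2 : ℝ) : EReal)
      ≤ (γ : EReal) * f z + ((1 / 2 * ‖z - c‖ ^ 2 : ℝ) : EReal)

section

variable {H : Type*} [NormedAddCommGroup H] [InnerProductSpace ℝ H]

/-! ### Subgradients and proximal points -/

lemma ne_top_of_mem_subdiff {f : H → EReal} (hf : ProperConvexLSC f) {x u : H}
    (hu : u ∈ subdiff f x) : f x ≠ ⊤ := by
  obtain ⟨-, ⟨z, hz⟩, -⟩ := hf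
  intro h
  have := hu z
  rw [h, EReal.top_add_coe, top_le_iff] at this
  exact hz this

/-- The subdifferential is monotone. -/
lemma subdiff_monotone {f : H → EReal} (hf : ProperConvexLSC f) {x u x' u' : H}
    (hu : u ∈ subdiff f x) (hu' : u' ∈ subdiff f x') : 0 ≤ ⟪u - u', x - x'⟫ := by
  have h1 := hu x'
  have h2 := hu' x
  lift f x to ℝ using ⟨ne_top_of_mem_subdiff hf hu, hf.1 x⟩ with a
  lift f x' to ℝ using ⟨ne_top_of_mem_subdiff hf hu', hf.1 x'⟩ with b
  norm_cast at h1 h2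
  simp only [inner_sub_left, inner_sub_right] at *
  linarith

lemma nonneg_of_forall_add_mul_nonneg {a b : ℝ}
    (h : ∀ t : ℝ, 0 < t → t ≤ 1 → 0 ≤ a + t * b) : 0 ≤ a := by
  have h1 : Tendsto (fun t : ℝ => a + t * b) (𝓝[>] 0) (𝓝 (a + 0 * b)) :=
    Tendsto.mono_left (Continuous.tendsto (by fun_prop) 0) nhdsWithin_le_nhds
  rw [zero_mul, add_zero] at h1
  refine ge_of_tendsto h1 ?_
  filter_upwards [Ioc_mem_nhdsGT (zero_lt_one' ℝ)] with t ht
  exact h t ht.1 ht.2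

/-- The optimality condition for proximal points. -/
lemma IsProx.mem_subdiff {f : H → EReal} (hf : ProperConvexLSC f) {γ : ℝ} (hγ : 0 < γ) {c p : H}
    (hp : IsProx γ f c p) : γ⁻¹ • (c - p) ∈ subdiff f p := by
  obtain ⟨hbot, ⟨z₀, hz₀⟩, hconv, -⟩ := hf
  have hptop : f p ≠ ⊤ := by
    intro h
    have := hp z₀
    rw [h, EReal.coe_mul_top_of_pos hγ, EReal.top_add_coe, top_le_iff] at this
    lift f z₀ to ℝ using ⟨hz₀, hbot z₀⟩ with b
    norm_cast at this
    exact EReal.coe_ne_top _ this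
  intro z
  by_cases hz : f z = ⊤
  · rw [hz]; exact le_top
  have key : ∀ t : ℝ, 0 < t → t ≤ 1 → ∀ a b : ℝ, f p = a → f z = b →
      0 ≤ (γ * (b - a) - ⟪c - p, z - p⟫) + t * (1 / 2 * ‖z - p‖ ^ 2) := by
    intro t ht ht1 a b ha hb
    have h1 := hconv p z (1 - t) t (by linarith) ht.le (by ring)
    have h2 := hp ((1 - t) • p + t • z)
    rw [ha, hb] at h1
    have htop : f ((1 - t) • p + t • z) ≠ ⊤ := by
      intro h
      rw [h, top_le_iff] at h1
      norm_cast at h1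
      exact EReal.coe_ne_top _ h1
    rw [ha] at h2
    have hbot' := hbot ((1 - t) • p + t • z)
    have hexp : ‖(1 - t) • p + t • z - c‖ ^ 2
        = ‖p - c‖ ^ 2 - 2 * t * ⟪c - p, z - p⟫ + t ^ 2 * ‖z - p‖ ^ 2 := by
      have : (1 - t) • p + t • z - c = t • (z - p) - (c - p) := by module
      rw [this, norm_sub_sq_real, norm_smul, mul_pow, inner_smul_left, norm_sub_rev p c,
        real_inner_comm]
      simp
      ring
    rw [hexp] at h2
    lift f ((1 - t) • p + t • z) to ℝ using ⟨htop, hbot'⟩ with d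
    norm_cast at h1 h2
    have h3 : 0 ≤ t * ((γ * (b - a) - ⟪c - p, z - p⟫) + t * (1 / 2 * ‖z - p‖ ^ 2)) := by
      nlinarith [mul_le_mul_of_nonneg_left h1 hγ.le]
    exact nonneg_of_mul_nonneg_right h3 ht
  have hpbot := hbot p
  have hzbot := hbot z
  lift f p to ℝ using ⟨hptop, hpbot⟩ with a
  lift f z to ℝ using ⟨hz, hzbot⟩ with b
  have h := nonneg_of_forall_add_mul_nonneg fun t ht ht1 => key t ht ht1 a b rfl rfl
  norm_cast
  rw [real_inner_smul_left]
  have : γ⁻¹ * ⟪c - p, z - p⟫ ≤ γ⁻¹ * (γ * (b - a)) :=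
    mul_le_mul_of_nonneg_left (by linarith) (inv_nonneg.2 hγ.le)
  rw [inv_mul_cancel_left₀ hγ.ne'] at this
  linarith

/-- Proximal maps are firmly nonexpansive. -/
lemma IsProx.inner_nonneg {f : H → EReal} (hf : ProperConvexLSC f) {γ : ℝ} (hγ : 0 < γ)
    {c p c' p' : H} (hp : IsProx γ f c p) (hp' : IsProx γ f c' p') :
    0 ≤ ⟪(c - p) - (c' - p'), p - p'⟫ := by
  have h := subdiff_monotone hf (hp.mem_subdiff hf hγ) (hp'.mem_subdiff hf hγ)
  rw [← smul_sub, real_inner_smul_left] at h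
  exact nonneg_of_mul_nonneg_right h (inv_pos.2 hγ)

lemma IsProx.eq_of_mem_subdiff {f : H → EReal} (hf : ProperConvexLSC f) {γ : ℝ} (hγ : 0 < γ)
    {c p x u : H} (hp : IsProx γ f c p) (hu : u ∈ subdiff f x) (hc : c = x + γ • u) : p = x := by
  have h := subdiff_monotone hf (hp.mem_subdiff hf hγ) hu
  have : γ⁻¹ • (c - p) - u = -(γ⁻¹ • (p - x)) := by
    rw [hc, add_sub_right_comm, smul_add, inv_smul_smul₀ hγ.ne', add_sub_cancel_right,
      ← smul_neg, neg_sub]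
  rw [this, inner_neg_left, real_inner_smul_left, real_inner_self_eq_norm_sq] at h
  have h0 : 0 ≤ γ⁻¹ * -‖p - x‖ ^ 2 := by linarith
  have h1 := nonneg_of_mul_nonneg_right h0 (inv_pos.2 hγ)
  have h2 : ‖p - x‖ = 0 := by nlinarith [norm_nonneg (p - x)]
  exact sub_eq_zero.1 (norm_eq_zero.1 h2)

/-! ### The Douglas–Rachford residual -/

/-- The residual `z ↦ prox_f (2 prox_g z - z) - prox_g z` of the Douglas–Rachford operator. -/
def drResidual (pf pg : H → H) (z : H) : H := pf ((2 : ℝ) • pg z - z) - pg z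

lemma drResidual_inner_le {f g : H → EReal} (hf : ProperConvexLSC f) (hg : ProperConvexLSC g)
    {γ : ℝ} (hγ : 0 < γ) {pf pg : H → H} (hpf : ∀ c, IsProx γ f c (pf c))
    (hpg : ∀ c, IsProx γ g c (pg c)) (z z' : H) :
    ⟪drResidual pf pg z - drResidual pf pg z', z - z'⟫
      ≤ -‖drResidual pf pg z - drResidual pf pg z'‖ ^ 2 := by
  have h1 := (hpg z).inner_nonneg hg hγ (hpg z')
  have h2 := (hpf ((2 : ℝ) • pg z - z)).inner_nonneg hf hγ (hpf ((2 : ℝ) • pg z' - z'))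
  unfold drResidual
  generalize pf ((2 : ℝ) • pg z - z) = x at *
  generalize pf ((2 : ℝ) • pg z' - z') = x' at *
  generalize pg z = y at *
  generalize pg z' = y' at *
  have e1 : z - y - (z' - y') = (z - z') - (y - y') := by abel
  have e2 : (2 : ℝ) • y - z - x - ((2 : ℝ) • y' - z' - x')
      = (2 : ℝ) • (y - y') - (z - z') - (x - x') := by module
  have e3 : x - y - (x' - y') = (x - x') - (y - y') := by abel
  rw [e1] at h1
  rw [e2] at h2
  rw [e3, norm_sub_sq_real]
  generalize x - x' = X at *
  generalize y - y' = Y at *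
  generalize z - z' = Z at *
  simp only [inner_sub_left, real_inner_smul_left, real_inner_self_eq_norm_sq] at *
  rw [real_inner_comm Z X, real_inner_comm Z Y]
  rw [real_inner_comm X Y] at h2
  linarith

lemma exists_drResidual_eq_zero {f g : H → EReal} (hf : ProperConvexLSC f)
    (hg : ProperConvexLSC g) {γ : ℝ} (hγ : 0 < γ) {pf pg : H → H}
    (hpf : ∀ c, IsProx γ f c (pf c)) (hpg : ∀ c, IsProx γ g c (pg c))
    (hzer : ∃ x : H, ∃ u ∈ subdiff f x, ∃ v ∈ subdiff g x, u + v = 0) :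
    ∃ z, drResidual pf pg z = 0 := by
  obtain ⟨x, u, hu, v, hv, huv⟩ := hzer
  obtain rfl : u = -v := eq_neg_of_add_eq_zero_left huv
  refine ⟨x + γ • v, ?_⟩
  have h1 : pg (x + γ • v) = x := (hpg _).eq_of_mem_subdiff hg hγ hv rfl
  rw [drResidual, h1, (hpf _).eq_of_mem_subdiff hf hγ hu (by module), sub_self]

lemma exists_subdiff_add_eq_zero {f g : H → EReal} (hf : ProperConvexLSC f)
    (hg : ProperConvexLSC g) {γ : ℝ} (hγ : 0 < γ) {pf pg : H → H}
    (hpf : ∀ c, IsProx γ f c (pf c)) (hpg : ∀ c, IsProx γ g c (pg c)) {z : H}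
    (hz : drResidual pf pg z = 0) :
    ∃ u ∈ subdiff f (pg z), ∃ v ∈ subdiff g (pg z), u + v = 0 := by
  have h1 := (hpf ((2 : ℝ) • pg z - z)).mem_subdiff hf hγ
  rw [sub_eq_zero.1 hz] at h1
  exact ⟨_, h1, _, (hpg z).mem_subdiff hg hγ, by module⟩

/-! ### Real sequences -/

lemma summable_of_le_mul_add {a d : ℕ → ℝ} {q : ℝ} (hq : q < 1) (ha : ∀ k, 0 ≤ a k)
    (hd0 : ∀ k, 0 ≤ d k) (hd : Summable d) (h : ∀ k, a (k + 1) ≤ q * a k + d k) :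
    Summable a := by
  refine summable_of_sum_range_le (c := (a 0 + ∑' k, d k) / (1 - q)) ha fun n => ?_
  rw [le_div_iff₀ (by linarith)]
  have h1 : ∑ k ∈ Finset.range n, a (k + 1)
      ≤ q * ∑ k ∈ Finset.range n, a k + ∑ k ∈ Finset.range n, d k := by
    rw [Finset.mul_sum, ← Finset.sum_add_distrib]
    exact Finset.sum_le_sum fun k _ => h k
  have h2 : ∑ k ∈ Finset.range n, d k ≤ ∑' k, d k :=
    hd.sum_le_tsum _ fun k _ => hd0 k
  have h3 := Finset.sum_range_succ' a n
  have h4 := Finset.sum_range_succ a n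
  have h5 := ha n
  linarith

/-- Convergence of nonnegative sequences obeying an inertial descent inequality. -/
lemma tendsto_of_inertial_descent {φ d s a : ℕ → ℝ} {q : ℝ} (hφ : ∀ k, 0 ≤ φ k) (hq : q < 1)
    (ha : ∀ k, 0 ≤ a k ∧ a k ≤ q) (hd0 : ∀ k, 0 ≤ d k) (hd : Summable d) (hs : ∀ k, 0 ≤ s k)
    (h : ∀ k, φ (k + 2) - φ (k + 1) ≤ a k * (φ (k + 1) - φ k) + d k - s k) :
    (∃ l, Tendsto φ atTop (𝓝 l)) ∧ Tendsto s atTop (𝓝 0) := by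
  have hq0 : 0 ≤ q := (ha 0).1.trans (ha 0).2
  set θ : ℕ → ℝ := fun k => max (φ (k + 1) - φ k) 0 with hθ
  have hθ0 : ∀ k, 0 ≤ θ k := fun k => le_max_right _ _
  have hstep : ∀ k, a k * (φ (k + 1) - φ k) ≤ q * θ k := fun k =>
    (mul_le_mul_of_nonneg_left (le_max_left _ _) (ha k).1).trans
      (mul_le_mul_of_nonneg_right (ha k).2 (hθ0 k))
  have hθs : Summable θ := by
    refine summable_of_le_mul_add hq hθ0 hd0 hd fun k => max_le ?_ ?_
    · linarith [h k, hstep k, hs k]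
    · exact add_nonneg (mul_nonneg hq0 (hθ0 k)) (hd0 k)
  have hanti : Antitone fun n => φ n - ∑ k ∈ Finset.range n, θ k := by
    refine antitone_nat_of_succ_le fun n => ?_
    rw [Finset.sum_range_succ]
    have : φ (n + 1) - φ n ≤ θ n := le_max_left _ _
    linarith
  have hbdd : BddBelow (Set.range fun n => φ n - ∑ k ∈ Finset.range n, θ k) := by
    refine ⟨-∑' k, θ k, ?_⟩
    rintro _ ⟨n, rfl⟩
    have := hθs.sum_le_tsum (Finset.range n) fun k _ => hθ0 k
    have := hφ n
    simp only
    linarith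
  have hlim := (tendsto_atTop_ciInf hanti hbdd).add hθs.hasSum.tendsto_sum_nat
  simp only [sub_add_cancel] at hlim
  refine ⟨⟨_, hlim⟩, ?_⟩
  have h1 := (tendsto_add_atTop_iff_nat 1).2 hlim
  have h2 := (tendsto_add_atTop_iff_nat 2).2 hlim
  have hup := ((h1.sub h2).add (hθs.tendsto_atTop_zero.const_mul q)).add hd.tendsto_atTop_zero
  rw [sub_self, mul_zero, add_zero, add_zero] at hup
  exact squeeze_zero hs (fun k => by linarith [h k, hstep k]) hup

/-! ### Weak convergence -/

lemma exists_tendsto_inner_of_bounded [CompleteSpace H] {w : ℕ → H} {C : ℝ}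
    (hC : ∀ k, ‖w k‖ ≤ C) (U : Ultrafilter ℕ) :
    ∃ p : H, ∀ z, Tendsto (fun k => ⟪w k, z⟫) U (𝓝 ⟪p, z⟫) := by
  let W : ℕ → WeakDual ℝ H := fun k =>
    StrongDual.toWeakDual (InnerProductSpace.toDual ℝ H (w k))
  have hK := WeakDual.isCompact_closedBall (𝕜 := ℝ) (E := H) 0 C
  have hU : ((U.map W : Ultrafilter (WeakDual ℝ H)) : Filter (WeakDual ℝ H)) ≤
      𝓟 (WeakDual.toStrongDual ⁻¹' Metric.closedBall (0 : StrongDual ℝ H) C) := by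
    rw [le_principal_iff]
    refine Filter.mem_map.2 (univ_mem' fun k => ?_)
    simpa [W] using hC k
  obtain ⟨L, -, hL⟩ := hK.ultrafilter_le_nhds _ hU
  refine ⟨(InnerProductSpace.toDual ℝ H).symm (WeakDual.toStrongDual L), fun z => ?_⟩
  have h := ((WeakDual.eval_continuous (𝕜 := ℝ) (E := H) z).tendsto L).comp
    (show Tendsto W U (𝓝 L) from hL)
  simpa [W, Function.comp_def] using h

lemma exists_norm_le_of_tendsto_norm_sub_sq {E : Type*} [NormedAddCommGroup E]
    {w : ℕ → E} {p : E} {l : ℝ}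
    (h : Tendsto (fun k => ‖w k - p‖ ^ 2) atTop (𝓝 l)) : ∃ C, ∀ k, ‖w k‖ ≤ C := by
  obtain ⟨M, hM⟩ := h.bddAbove_range
  refine ⟨M + 1 + ‖p‖, fun k => ?_⟩
  have h1 : ‖w k - p‖ ^ 2 ≤ M := hM ⟨k, rfl⟩
  have h2 : ‖w k‖ ≤ ‖w k - p‖ + ‖p‖ := by simpa using norm_add_le (w k - p) p
  nlinarith [sq_nonneg (‖w k - p‖ - 1), sq_nonneg ‖w k - p‖]

/-- Opial's lemma, with weak cluster points taken along ultrafilters. -/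
lemma exists_weakTendsto_of_opial [CompleteSpace H] {w : ℕ → H} {F : Set H} (hF : F.Nonempty)
    (hdist : ∀ p ∈ F, ∃ l, Tendsto (fun k => ‖w k - p‖ ^ 2) atTop (𝓝 l))
    (hcluster : ∀ U : Ultrafilter ℕ, (U : Filter ℕ) ≤ atTop → ∀ p : H,
      (∀ z, Tendsto (fun k => ⟪w k, z⟫) U (𝓝 ⟪p, z⟫)) → p ∈ F) :
    ∃ p ∈ F, WeakTendsto w p := by
  obtain ⟨C, hC⟩ : ∃ C, ∀ k, ‖w k‖ ≤ C := by
    obtain ⟨p, hp⟩ := hF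
    obtain ⟨l, hl⟩ := hdist p hp
    exact exists_norm_le_of_tendsto_norm_sub_sq hl
  obtain ⟨p, hp⟩ := exists_tendsto_inner_of_bounded hC (hyperfilter ℕ)
  have hU₀ : ((hyperfilter ℕ : Ultrafilter ℕ) : Filter ℕ) ≤ atTop :=
    Nat.cofinite_eq_atTop ▸ hyperfilter_le_cofinite
  have hpF := hcluster _ hU₀ p hp
  refine ⟨p, hpF, fun z => tendsto_iff_ultrafilter _ _ _ |>.2 fun V hV => ?_⟩
  obtain ⟨q, hq⟩ := exists_tendsto_inner_of_bounded hC V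
  have hqF := hcluster V hV q hq
  obtain ⟨lp, hlp⟩ := hdist p hpF
  obtain ⟨lq, hlq⟩ := hdist q hqF
  have hconv : ∃ c, Tendsto (fun k => ⟪w k, p - q⟫) atTop (𝓝 c) := by
    refine ⟨_, (((hlq.sub hlp).add_const (‖p‖ ^ 2 - ‖q‖ ^ 2)).div_const 2).congr fun k => ?_⟩
    rw [norm_sub_sq_real, norm_sub_sq_real, inner_sub_right]
    ring
  obtain ⟨c, hc⟩ := hconv
  have h1 := tendsto_nhds_unique (hc.mono_left hU₀) (hp (p - q))
  have h2 := tendsto_nhds_unique (hc.mono_left hV) (hq (p - q))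
  have h3 : ⟪p - q, p - q⟫ = 0 := by
    rw [inner_sub_left, ← h1, ← h2, sub_self]
  rw [sub_eq_zero.1 (inner_self_eq_zero.1 h3)]
  exact hq z

/-- Demiclosedness at `0` of a firmly monotone residual. -/
lemma eq_zero_of_tendsto_inner {S : H → H}
    (hS : ∀ z z', ⟪S z - S z', z - z'⟫ ≤ -‖S z - S z'‖ ^ 2) {z : ℕ → H} {p : H} {C : ℝ}
    (hC : ∀ k, ‖z k‖ ≤ C) {U : Filter ℕ} [U.NeBot]
    (hz : ∀ v, Tendsto (fun k => ⟪z k, v⟫) U (𝓝 ⟪p, v⟫))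
    (hSz : Tendsto (fun k => S (z k)) U (𝓝 0)) : S p = 0 := by
  have h1 : Tendsto (fun k => ⟪S (z k), z k - p⟫) U (𝓝 0) := by
    refine squeeze_zero_norm (a := fun k => ‖S (z k)‖ * (C + ‖p‖)) (fun k => ?_) ?_
    · exact (norm_inner_le_norm _ _).trans (mul_le_mul_of_nonneg_left
        ((norm_sub_le _ _).trans (by linarith [hC k])) (norm_nonneg _))
    · simpa using hSz.norm.mul_const (C + ‖p‖)
  have h2 : Tendsto (fun k => ⟪S p, z k - p⟫) U (𝓝 0) := by
    have := (hz (S p)).sub_const ⟪p, S p⟫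
    rw [sub_self] at this
    refine this.congr fun k => ?_
    rw [inner_sub_right, real_inner_comm, real_inner_comm p]
  have h3 : Tendsto (fun k => -‖S (z k) - S p‖ ^ 2) U (𝓝 (-‖0 - S p‖ ^ 2)) :=
    ((hSz.sub_const (S p)).norm.pow 2).neg
  have h4 := le_of_tendsto_of_tendsto' (h1.sub h2) h3 fun k => by
    rw [← inner_sub_left]
    exact hS (z k) p
  rw [sub_self, zero_sub, norm_neg] at h4
  have : ‖S p‖ = 0 := by nlinarith [norm_nonneg (S p)]
  exact norm_eq_zero.1 this

/-! ### The inertial iteration -/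

lemma norm_inertial_sub_sq (a b p : H) (t : ℝ) :
    ‖a + t • (a - b) - p‖ ^ 2
      = (1 + t) * ‖a - p‖ ^ 2 - t * ‖b - p‖ ^ 2 + t * (1 + t) * ‖a - b‖ ^ 2 := by
  have e1 : a + t • (a - b) - p = (a - p) + t • (a - b) := by abel
  have e2 : b - p = (a - p) - (a - b) := by abel
  rw [e1, e2]
  generalize a - p = c
  rw [norm_add_sq_real, norm_sub_sq_real, norm_smul, mul_pow, real_inner_smul_right,
    Real.norm_eq_abs, sq_abs]
  ring

lemma norm_relaxed_step_sub_sq_le {S : H → H}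
    (hS : ∀ z z', ⟪S z - S z', z - z'⟫ ≤ -‖S z - S z'‖ ^ 2) {p : H} (hp : S p = 0) {t : ℝ}
    (ht : 0 ≤ t) (z : H) :
    ‖z + t • S z - p‖ ^ 2 ≤ ‖z - p‖ ^ 2 - t * (2 - t) * ‖S z‖ ^ 2 := by
  have h := hS z p
  rw [hp, sub_zero] at h
  rw [add_sub_right_comm, norm_add_sq_real, norm_smul, mul_pow, real_inner_smul_right,
    Real.norm_eq_abs, sq_abs, real_inner_comm]
  nlinarith [mul_le_mul_of_nonneg_left h ht]

/-- Inertial relaxed iterations of `z ↦ z + S z` for a firmly monotone residual `S`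
converge weakly to a zero of `S`. -/
lemma exists_weakTendsto_inertial_iteration [CompleteSpace H] {S : H → H}
    (hS : ∀ z z', ⟪S z - S z', z - z'⟫ ≤ -‖S z - S z'‖ ^ 2) (hzero : ∃ p, S p = 0)
    {a t : ℕ → ℝ} {q lo hi : ℝ} (ha : ∀ k, 0 ≤ a k ∧ a k ≤ q) (hq : q < 1) (hlo : 0 < lo)
    (ht : ∀ k, lo ≤ t k ∧ t k ≤ hi) (hhi : hi < 2) {w z : ℕ → H}
    (hz : ∀ k, z k = w (k + 1) + a k • (w (k + 1) - w k))
    (hw : ∀ k, w (k + 2) = z k + t k • S (z k))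
    (hsum : Summable fun k => a k * ‖w (k + 1) - w k‖ ^ 2) :
    ∃ p, S p = 0 ∧ WeakTendsto w p ∧ Tendsto (fun k => S (z k)) atTop (𝓝 0) := by
  have hc : 0 < lo * (2 - hi) := mul_pos hlo (by linarith)
  have hmain : ∀ p, S p = 0 → (∃ l, Tendsto (fun k => ‖w k - p‖ ^ 2) atTop (𝓝 l)) ∧
      Tendsto (fun k => lo * (2 - hi) * ‖S (z k)‖ ^ 2) atTop (𝓝 0) := by
    intro p hp
    refine tendsto_of_inertial_descent (a := a)
      (d := fun k => 2 * (a k * ‖w (k + 1) - w k‖ ^ 2)) (fun k => by positivity) hq ha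
      (fun k => mul_nonneg zero_le_two (mul_nonneg (ha k).1 (sq_nonneg _))) (hsum.mul_left 2)
      (fun k => mul_nonneg hc.le (sq_nonneg _)) fun k => ?_
    have h1 := norm_relaxed_step_sub_sq_le hS hp (hlo.le.trans (ht k).1) (z k)
    have h2 := norm_inertial_sub_sq (w (k + 1)) (w k) p (a k)
    rw [← hw] at h1
    rw [← hz] at h2
    have h3 : lo * (2 - hi) ≤ t k * (2 - t k) :=
      mul_le_mul (ht k).1 (by linarith [(ht k).2]) (by linarith) (hlo.le.trans (ht k).1)
    have h4 := mul_le_mul_of_nonneg_right h3 (sq_nonneg ‖S (z k)‖)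
    have h5 : 0 ≤ (1 - a k) * (a k * ‖w (k + 1) - w k‖ ^ 2) :=
      mul_nonneg (by linarith [(ha k).2]) (mul_nonneg (ha k).1 (sq_nonneg _))
    linarith
  obtain ⟨p₀, hp₀⟩ := hzero
  have hSz : Tendsto (fun k => S (z k)) atTop (𝓝 0) := by
    have h := (hmain p₀ hp₀).2.const_mul (lo * (2 - hi))⁻¹
    simp only [inv_mul_cancel_left₀ hc.ne', mul_zero] at h
    rw [tendsto_zero_iff_norm_tendsto_zero]
    simpa [Real.sqrt_sq] using h.sqrt
  have hdiff : Tendsto (fun k => z k - w (k + 1)) atTop (𝓝 0) := by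
    rw [tendsto_zero_iff_norm_tendsto_zero]
    have h := hsum.tendsto_atTop_zero.sqrt
    rw [Real.sqrt_zero] at h
    refine squeeze_zero (fun _ => norm_nonneg _) (fun k => Real.le_sqrt_of_sq_le ?_) h
    rw [hz, add_sub_cancel_left, norm_smul, mul_pow, Real.norm_eq_abs, sq_abs]
    refine mul_le_mul_of_nonneg_right ?_ (sq_nonneg _)
    nlinarith [ha k]
  obtain ⟨l, hl⟩ := (hmain p₀ hp₀).1
  obtain ⟨C, hC⟩ := exists_norm_le_of_tendsto_norm_sub_sq hl
  obtain ⟨M, hM⟩ := hdiff.norm.bddAbove_range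
  have hbound : ∀ k, ‖z k‖ ≤ M + C := fun k => by
    have h1 : ‖z k - w (k + 1)‖ ≤ M := hM ⟨k, rfl⟩
    have h2 : ‖z k‖ ≤ ‖z k - w (k + 1)‖ + ‖w (k + 1)‖ := by
      simpa using norm_add_le (z k - w (k + 1)) (w (k + 1))
    linarith [hC (k + 1)]
  suffices hcluster : ∀ U : Ultrafilter ℕ, (U : Filter ℕ) ≤ atTop → ∀ p : H,
      (∀ v, Tendsto (fun k => ⟪w k, v⟫) U (𝓝 ⟪p, v⟫)) → S p = 0 by
    obtain ⟨p, hp, hwp⟩ := exists_weakTendsto_of_opial (F := {p | S p = 0}) ⟨p₀, hp₀⟩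
      (fun p hp => (hmain p hp).1) hcluster
    exact ⟨p, hp, hwp, hSz⟩
  intro U hU p hU'
  have hpred := (tendsto_sub_atTop_nat 1).mono_left hU
  refine eq_zero_of_tendsto_inner (z := fun k => z (k - 1)) (U := U) hS (fun k => hbound _)
    (fun v => ?_) (hSz.comp hpred)
  have h := ((hdiff.comp hpred).inner (tendsto_const_nhds (x := v))).add (hU' v)
  rw [inner_zero_left, zero_add] at h
  refine h.congr' ?_
  filter_upwards [hU (eventually_ge_atTop 1)] with k hk
  rw [Function.comp_apply, Nat.sub_add_cancel hk, ← inner_add_left, sub_add_cancel]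

end

theorem inertial_DR_basic_convergence
    {H : Type*} [NormedAddCommGroup H] [InnerProductSpace ℝ H] [CompleteSpace H]
    (f g : H → EReal) (hf : ProperConvexLSC f) (hg : ProperConvexLSC g)
    (γ : ℝ) (hγ : 0 < γ)
    (proxf proxg : H → H)
    (hproxf : ∀ c, IsProx γ f c (proxf c)) (hproxg : ∀ c, IsProx γ g c (proxg c))
    (hzer : ∃ x : H, ∃ u ∈ subdiff f x, ∃ v ∈ subdiff g x, u + v = 0)
    (α lam : ℕ → ℝ) (αbar llo lhi : ℝ)
    (hα : ∀ k, 0 ≤ α k ∧ α k ≤ αbar) (hαbar : αbar < 1)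
    (hllo : 0 < llo) (hlam : ∀ k, llo ≤ lam k ∧ lam k ≤ lhi) (hlhi : lhi < 2)
    (w y x : ℕ → H)
    (hy : ∀ k, 1 ≤ k → y k = proxg (w k + α k • (w k - w (k - 1))))
    (hx : ∀ k, 1 ≤ k → x k = proxf ((2 : ℝ) • y k - w k - α k • (w k - w (k - 1))))
    (hw : ∀ k, 1 ≤ k → w (k + 1) = w k + α k • (w k - w (k - 1)) + lam k • (x k - y k))
    (hsum : Summable fun k => α (k + 1) * ‖w (k + 1) - w k‖ ^ 2) :
    ∃ xbar : H,
      (∃ u ∈ subdiff f (proxg xbar), ∃ v ∈ subdiff g (proxg xbar), u + v = 0) ∧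
      WeakTendsto w xbar ∧
      Tendsto (fun k => ‖y k - x k‖) atTop (𝓝 0) := by
  obtain ⟨p, hp, hwp, hS⟩ := exists_weakTendsto_inertial_iteration
    (drResidual_inner_le hf hg hγ hproxf hproxg)
    (exists_drResidual_eq_zero hf hg hγ hproxf hproxg hzer)
    (a := fun k => α (k + 1)) (t := fun k => lam (k + 1)) (w := w)
    (z := fun k => w (k + 1) + α (k + 1) • (w (k + 1) - w k))
    (fun k => hα (k + 1)) hαbar hllo (fun k => hlam (k + 1)) hlhi (fun _ => rfl)
    (fun k => by
      rw [hw (k + 1) (by simp), hx (k + 1) (by simp), hy (k + 1) (by simp), drResidual,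
        add_tsub_cancel_right, sub_sub])
    hsum
  refine ⟨p, exists_subdiff_add_eq_zero hf hg hγ hproxf hproxg hp, hwp, ?_⟩
  rw [← tendsto_add_atTop_iff_nat 1]
  have h := hS.norm
  rw [norm_zero] at h
  refine h.congr fun k => ?_
  rw [hx (k + 1) (by simp), hy (k + 1) (by simp), norm_sub_rev, drResidual,
    add_tsub_cancel_right, sub_sub]
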